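/- Let n ≥ 2, r ∈ (0, π/4), and let a, z, p ∈ Sⁿ. Let b ∈ Sⁿ be a unit vector with b·a = 0, b·z = 0 and b·p > 0. Then ∫_{B_{p,r}} g(z·F_a(v)) (b·v) dv > 0. -/

import Mathlib

open MeasureTheory Real
open scoped RealInnerProductSpace

noncomputable section

/-- The unit sphere `Sⁿ ⊆ ℝ^{n+1}`. -/
def sph (n : ℕ) : Set (EuclideanSpace ℝ (Fin (n + 1))) := Metric.sphere 0 1

/-- Reflection `R_a(z) = z - 2(z·a)a` across the hyperplane `a^⊥`. -/
def sphRefl (n : ℕ) (a z : EuclideanSpace ℝ (Fin (n + 1))) : EuclideanSpace ℝ (Fin (n + 1)) :=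
  z - (2 * ⟪z, a⟫) • a

/-- The folding map `F_a` : reflect the open half-sphere `{z·a > 0}` onto `{z·a < 0}`. -/
def fold (n : ℕ) (a z : EuclideanSpace ℝ (Fin (n + 1))) : EuclideanSpace ℝ (Fin (n + 1)) :=
  if 0 < ⟪z, a⟫ then sphRefl n a z else z

/-- Projection `π_z(w) = w - (w·z)z` onto the tangent space `z^⊥`. -/
def proj (n : ℕ) (z w : EuclideanSpace ℝ (Fin (n + 1))) : EuclideanSpace ℝ (Fin (n + 1)) :=
  w - ⟪w, z⟫ • z

/-- The open geodesic ball `B_{p,r}` on the unit sphere: points of the sphere at geodesic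
(angular) distance `arccos (p·v) < r` from `p`. -/
def gball (n : ℕ) (p : EuclideanSpace ℝ (Fin (n + 1))) (r : ℝ) :
    Set (EuclideanSpace ℝ (Fin (n + 1))) :=
  {v | v ∈ sph n ∧ Real.arccos ⟪p, v⟫ < r}

/-- `G(t) = ∫₀ᵗ g(s) ds`. -/
def Gfun (g : ℝ → ℝ) (t : ℝ) : ℝ := ∫ s in (0:ℝ)..t, g s

open Filter Topology in
lemma aux_pos (n : ℕ) (U : Set (EuclideanSpace ℝ (Fin (n + 1)))) (hU : IsOpen U)
    (x : EuclideanSpace ℝ (Fin (n + 1))) (hx : x ∈ sph n) (hxU : x ∈ U) :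
    0 < (μH[(n:ℝ)] : Measure (EuclideanSpace ℝ (Fin (n + 1)))) (U ∩ sph n) := by
  have hx1 : ‖x‖ = 1 := by simpa [sph] using hx
  have hv : ‖-x‖ = 1 := by simpa using hx1
  have hdim : Module.finrank ℝ (ℝ ∙ (-x))ᗮ = n := by
    have : Fact (Module.finrank ℝ (EuclideanSpace ℝ (Fin (n + 1))) = n + 1) := ⟨by simp⟩
    exact Submodule.finrank_orthogonal_span_singleton (by intro h; simp [h] at hv)
  have hopen : IsOpen {y : EuclideanSpace ℝ (Fin (n + 1)) | innerSL ℝ (-x) y ≠ (1 : ℝ)} :=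
    isOpen_ne_fun (innerSL ℝ (-x)).continuous continuous_const
  have hmem : innerSL ℝ (-x) x ≠ (1 : ℝ) := by
    simp [hx1]; norm_num
  have hcd : ContDiffAt ℝ 1 (stereoToFun (-x)) x :=
    contDiffOn_stereoToFun.contDiffAt (hopen.mem_nhds hmem)
  obtain ⟨K, t, ht, hK⟩ := hcd.exists_lipschitzOnWith
  set ψ : (ℝ ∙ (-x))ᗮ → EuclideanSpace ℝ (Fin (n + 1)) := fun w => (stereoInvFun hv w : _) with hψ
  have hψc : Continuous ψ := continuous_subtype_val.comp (continuous_stereoInvFun hv)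
  have hψ0 : ψ 0 = x := by
    simp [hψ, smul_smul]
  have hnh : ψ ⁻¹' (U ∩ t) ∈ 𝓝 0 := by
    apply hψc.continuousAt
    rw [hψ0]
    exact inter_mem (hU.mem_nhds hxU) ht
  have hsub : ψ ⁻¹' (U ∩ t) ⊆ stereoToFun (-x) '' (t ∩ (U ∩ sph n)) := by
    intro w hw
    exact ⟨ψ w, ⟨hw.2, hw.1, (stereoInvFun hv w).2⟩, stereo_right_inv hv w⟩
  have h1 : 0 < (μH[(n:ℝ)] : Measure (ℝ ∙ (-x))ᗮ) (ψ ⁻¹' (U ∩ t)) := by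
    have := isAddHaarMeasure_hausdorffMeasure (E := (ℝ ∙ (-x))ᗮ)
    rw [hdim] at this
    exact Measure.measure_pos_of_mem_nhds _ hnh
  have h2 := (hK.mono (Set.inter_subset_left (t := U ∩ sph n))).hausdorffMeasure_image_le
    (d := n) (by positivity)
  have h3 : (μH[(n:ℝ)] : Measure (EuclideanSpace ℝ (Fin (n + 1)))) (t ∩ (U ∩ sph n)) ≠ 0 := by
    intro h0
    rw [h0, mul_zero] at h2
    exact absurd (h1.trans_le ((measure_mono hsub).trans h2)) (lt_irrefl _)
  exact (pos_iff_ne_zero.2 h3).trans_le (measure_mono Set.inter_subset_right)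

open Filter Topology in
lemma aux_fin (n : ℕ) :
    (μH[(n:ℝ)] : Measure (EuclideanSpace ℝ (Fin (n + 1)))) (sph n) < ⊤ := by
  have hc : IsCompact (sph n) := isCompact_sphere _ _
  refine hc.measure_lt_top_of_nhdsWithin fun x hx => ?_
  have hx1 : ‖x‖ = 1 := by simpa [sph] using hx
  have hv : ‖-x‖ = 1 := by simpa using hx1
  have hdim : Module.finrank ℝ (ℝ ∙ (-x))ᗮ = n := by
    have : Fact (Module.finrank ℝ (EuclideanSpace ℝ (Fin (n + 1))) = n + 1) := ⟨by simp⟩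
    exact Submodule.finrank_orthogonal_span_singleton (by intro h; simp [h] at hv)
  have hopen : IsOpen {y : EuclideanSpace ℝ (Fin (n + 1)) | innerSL ℝ (-x) y ≠ (1 : ℝ)} :=
    isOpen_ne_fun (innerSL ℝ (-x)).continuous continuous_const
  have hmem : innerSL ℝ (-x) x ≠ (1 : ℝ) := by
    simp [hx1]; norm_num
  have hcd : ContinuousAt (stereoToFun (-x)) x :=
    continuousOn_stereoToFun.continuousAt (hopen.mem_nhds hmem)
  set ψ : (ℝ ∙ (-x))ᗮ → EuclideanSpace ℝ (Fin (n + 1)) := fun w => (stereoInvFun hv w : _) with hψ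
  have hψ0 : ψ 0 = x := by
    simp [hψ, smul_smul]
  have h0 : stereoToFun (-x) x = 0 := by
    have := stereo_right_inv hv 0
    rwa [show ((stereoInvFun hv 0 : _) : EuclideanSpace ℝ (Fin (n + 1))) = x from hψ0] at this
  have hψd : ContDiff ℝ 1 ψ :=
    contDiff_stereoInvFunAux.comp (ℝ ∙ (-x))ᗮ.subtypeL.contDiff
  obtain ⟨K, t, ht, hK⟩ := (hψd.contDiffAt (x := 0)).exists_lipschitzOnWith
  have ht' : t ∩ Metric.closedBall 0 1 ∈ 𝓝 (0 : (ℝ ∙ (-x))ᗮ) :=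
    inter_mem ht (Metric.closedBall_mem_nhds _ one_pos)
  refine ⟨ψ '' (t ∩ Metric.closedBall 0 1), ?_, ?_⟩
  · have e1 := hcd.preimage_mem_nhds (by rw [h0]; exact ht')
    filter_upwards [self_mem_nhdsWithin, mem_nhdsWithin_of_mem_nhds e1,
      mem_nhdsWithin_of_mem_nhds (hopen.mem_nhds hmem)] with y hy1 hy2 hy3
    refine ⟨_, hy2, ?_⟩
    have := stereo_left_inv hv (x := ⟨y, hy1⟩) (by
      rintro h
      apply hy3
      simp only at h
      rw [h]; simp [hx1])
    exact congrArg Subtype.val this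
  · refine ((hK.mono Set.inter_subset_left).hausdorffMeasure_image_le
      (d := n) (by positivity)).trans_lt ?_
    have := isAddHaarMeasure_hausdorffMeasure (E := (ℝ ∙ (-x))ᗮ)
    rw [hdim] at this
    refine ENNReal.mul_lt_top (ENNReal.rpow_lt_top_of_nonneg (by positivity) (by simp)) ?_
    exact (measure_mono Set.inter_subset_right).trans_lt
      (isCompact_closedBall _ _).measure_lt_top

lemma gball_iff (n : ℕ) (p v : EuclideanSpace ℝ (Fin (n + 1))) (hp : p ∈ sph n) (r : ℝ)
    (h0 : 0 < r) (h1 : r < π) :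
    v ∈ gball n p r ↔ v ∈ sph n ∧ Real.cos r < ⟪p, v⟫ := by
  unfold gball
  simp only [Set.mem_ofPred_eq]
  refine and_congr_right fun hv => ?_
  have hp1 : ‖p‖ = 1 := by simpa [sph] using hp
  have hv1 : ‖v‖ = 1 := by simpa [sph] using hv
  have hab := abs_le.1 (abs_real_inner_le_norm p v)
  rw [hp1, hv1] at hab
  have hab : -1 ≤ ⟪p, v⟫ ∧ ⟪p, v⟫ ≤ 1 := by simpa using hab
  constructor
  · intro h
    have := Real.cos_lt_cos_of_nonneg_of_le_pi (Real.arccos_nonneg _) h1.le h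
    rwa [Real.cos_arccos hab.1 hab.2] at this
  · intro h
    have := Real.arccos_lt_arccos (Real.neg_one_le_cos r) h hab.2
    rwa [Real.arccos_cos h0.le h1.le] at this

lemma exists_refl (n : ℕ) (b : EuclideanSpace ℝ (Fin (n + 1))) (hb : b ∈ sph n) :
    ∃ e : EuclideanSpace ℝ (Fin (n + 1)) ≃ₗᵢ[ℝ] EuclideanSpace ℝ (Fin (n + 1)),
      ∀ v, e v = v - (2 * ⟪b, v⟫) • b := by
  have hb1 : ‖b‖ = 1 := by simpa [sph] using hb
  refine ⟨(ℝ ∙ b)ᗮ.reflection, fun v => ?_⟩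
  rw [Submodule.reflection_orthogonal_apply, Submodule.reflection_singleton_apply]
  simp [hb1, two_smul, two_mul, add_smul]

lemma exists_pt (n : ℕ) (hn : 2 ≤ n) (r : ℝ) (h0 : 0 < r) (h1 : r < π / 4)
    (b p : EuclideanSpace ℝ (Fin (n + 1))) (hp : p ∈ sph n) (hbp : 0 < ⟪b, p⟫) :
    ∃ v ∈ sph n, Real.cos r < ⟪p, v⟫ ∧ ⟪p, v⟫ - 2 * ⟪b, v⟫ * ⟪b, p⟫ < Real.cos r := by
  have hp1 : ‖p‖ = 1 := by simpa [sph] using hp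
  have hpi := Real.pi_pos
  obtain ⟨w, hw1, hwp, hwb⟩ : ∃ w : EuclideanSpace ℝ (Fin (n + 1)),
      ‖w‖ = 1 ∧ ⟪p, w⟫ = 0 ∧ 0 ≤ ⟪b, w⟫ := by
    have hdim : Module.finrank ℝ (ℝ ∙ p)ᗮ = n := by
      have : Fact (Module.finrank ℝ (EuclideanSpace ℝ (Fin (n + 1))) = n + 1) := ⟨by simp⟩
      exact Submodule.finrank_orthogonal_span_singleton (by intro h; simp [h] at hp1)
    have : Nontrivial (ℝ ∙ p)ᗮ := Module.nontrivial_of_finrank_pos (R := ℝ) (by omega)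
    obtain ⟨u, hu⟩ := exists_norm_eq (ℝ ∙ p)ᗮ (zero_le_one (α := ℝ))
    have hup : ⟪p, (u : EuclideanSpace ℝ (Fin (n + 1)))⟫ = 0 :=
      Submodule.mem_orthogonal_singleton_iff_inner_right.mp u.2
    rcases le_total 0 ⟪b, (u : EuclideanSpace ℝ (Fin (n + 1)))⟫ with h | h
    · exact ⟨u, by simpa using hu, hup, h⟩
    · exact ⟨-u, by simpa using hu, by simp [hup], by simpa using h⟩
  set V : ℝ → EuclideanSpace ℝ (Fin (n + 1)) := fun θ => Real.cos θ • p + Real.sin θ • w with hV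
  have hpV : ∀ θ, ⟪p, V θ⟫ = Real.cos θ := by
    intro θ; simp [hV, inner_add_right, inner_smul_right, hwp, hp1]
  have hbV : ∀ θ, ⟪b, V θ⟫ = Real.cos θ * ⟪b, p⟫ + Real.sin θ * ⟪b, w⟫ := by
    intro θ; simp [hV, inner_add_right, inner_smul_right]
  have hVs : ∀ θ, V θ ∈ sph n := by
    intro θ
    have : ‖V θ‖ ^ 2 = 1 := by
      simp only [hV]
      rw [norm_add_sq_real]
      simp [norm_smul, inner_smul_left, inner_smul_right, hwp, hp1, hw1]
    have : ‖V θ‖ = 1 := by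
      have h := norm_nonneg (V θ)
      nlinarith
    simpa [sph] using this
  set f : ℝ → ℝ := fun θ => Real.cos θ - 2 * (Real.cos θ * ⟪b, p⟫ + Real.sin θ * ⟪b, w⟫) * ⟪b, p⟫
    with hf
  have hfc : Continuous f := by fun_prop
  have hfr : f r < Real.cos r := by
    have hc : 0 < Real.cos r := Real.cos_pos_of_mem_Ioo ⟨by linarith, by linarith⟩
    have hs : 0 ≤ Real.sin r := Real.sin_nonneg_of_nonneg_of_le_pi h0.le (by linarith)
    have : 0 < (Real.cos r * ⟪b, p⟫ + Real.sin r * ⟪b, w⟫) * ⟪b, p⟫ := by positivity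
    simp only [hf]; nlinarith
  have hev : ∀ᶠ θ in nhdsWithin r (Set.Iio r), f θ < Real.cos r :=
    (hfc.continuousAt.eventually (Iio_mem_nhds hfr)).filter_mono nhdsWithin_le_nhds
  have hev2 : ∀ᶠ θ in nhdsWithin r (Set.Iio r), 0 < θ :=
    (Ioi_mem_nhds h0 : Set.Ioi 0 ∈ nhds r) |> mem_nhdsWithin_of_mem_nhds
  obtain ⟨θ, hθ1, hθ2, hθ3⟩ := (hev.and (hev2.and self_mem_nhdsWithin)).exists
  refine ⟨V θ, hVs θ, ?_, ?_⟩
  · rw [hpV]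
    exact Real.cos_lt_cos_of_nonneg_of_le_pi hθ2.le (by linarith) hθ3
  · rw [hpV, hbV]; exact hθ1

lemma norm_fold (n : ℕ) (a v : EuclideanSpace ℝ (Fin (n + 1))) (ha : a ∈ sph n) :
    ‖fold n a v‖ = ‖v‖ := by
  unfold fold
  split_ifs
  · obtain ⟨e, he⟩ := exists_refl n a ha
    have := e.norm_map v
    rw [he, real_inner_comm] at this
    exact this
  · rfl

lemma inner_fold (n : ℕ) (a b v : EuclideanSpace ℝ (Fin (n + 1))) (h : ⟪b, a⟫ = 0) :
    ⟪b, fold n a v⟫ = ⟪b, v⟫ := by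
  unfold fold sphRefl
  split_ifs <;> simp [inner_sub_right, inner_smul_right, h]

lemma fold_meas (n : ℕ) (a : EuclideanSpace ℝ (Fin (n + 1))) : Measurable (fold n a) := by
  unfold fold sphRefl
  refine Measurable.ite ?_ (Continuous.measurable (by fun_prop)) measurable_id
  exact (isOpen_lt continuous_const (by fun_prop)).measurableSet

set_option maxHeartbeats 2000000

/-- For `r ∈ (0, π/4)`, `a, z, p ∈ Sⁿ` and a unit vector `b` with
`b·a = 0`, `b·z = 0` and `b·p > 0`, one has `∫_{B_{p,r}} g(z·F_a v)(b·v) dv > 0`. -/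
theorem statement6 (n : ℕ) (hn : 2 ≤ n)
    (g : ℝ → ℝ) (hg_cont : ContinuousOn g (Set.Icc (-1) 1))
    (hg_even : ∀ t, g (-t) = g t)
    (hg_nonneg : ∀ t ∈ Set.Icc (-1:ℝ) 1, 0 ≤ g t)
    (hg_pos : ∀ t ∈ Set.Ioo (-1:ℝ) 1, 0 < g t)
    (r : ℝ) (hr : r ∈ Set.Ioo 0 (π / 4))
    (a z p : EuclideanSpace ℝ (Fin (n + 1)))
    (ha : a ∈ sph n) (hz : z ∈ sph n) (hp : p ∈ sph n)
    (b : EuclideanSpace ℝ (Fin (n + 1))) (hb : b ∈ sph n)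
    (hba : ⟪b, a⟫ = 0) (hbz : ⟪b, z⟫ = 0) (hbp : 0 < ⟪b, p⟫) :
    0 < ∫ v in gball n p r, g ⟪z, fold n a v⟫ * ⟪b, v⟫ ∂μH[(n:ℝ)] := by
  obtain ⟨hr0, hr1⟩ := hr
  have hpi := Real.pi_pos
  have hrpi : r < π := by linarith
  have hz1 : ‖z‖ = 1 := by simpa [sph] using hz
  have hb1 : ‖b‖ = 1 := by simpa [sph] using hb
  set g' : ℝ → ℝ := fun t => g (max (-1) (min 1 t)) with hg'
  have hclamp : ∀ t : ℝ, max (-1) (min 1 t) ∈ Set.Icc (-1 : ℝ) 1 := fun t =>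
    ⟨le_max_left _ _, max_le (by norm_num) (min_le_left _ _)⟩
  have hg'c : Continuous g' :=
    hg_cont.comp_continuous (by fun_prop) hclamp
  have hg'0 : ∀ t, 0 ≤ g' t := fun t => hg_nonneg _ (hclamp t)
  have hg'eq : ∀ t, -1 ≤ t → t ≤ 1 → g' t = g t := by
    intro t h1 h2; simp [hg', h1, h2]
  obtain ⟨C, hC⟩ := isCompact_Icc.exists_bound_of_continuousOn hg_cont
  have hg'C : ∀ t, ‖g' t‖ ≤ C := fun t => hC _ (hclamp t)
  have hsm : MeasurableSet (sph n) := Metric.isClosed_sphere.measurableSet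
  have hB : MeasurableSet (gball n p r) := by
    have : gball n p r = sph n ∩ {v | Real.cos r < ⟪p, v⟫} := by
      ext v; exact gball_iff n p v hp r hr0 hrpi
    rw [this]
    exact hsm.inter (isOpen_lt continuous_const (by fun_prop)).measurableSet
  have hin : ∀ v ∈ sph n, -1 ≤ ⟪z, fold n a v⟫ ∧ ⟪z, fold n a v⟫ ≤ 1 := by
    intro v hv
    have hv1 : ‖v‖ = 1 := by simpa [sph] using hv
    have := abs_real_inner_le_norm z (fold n a v)
    rw [norm_fold n a v ha, hz1, hv1, mul_one] at this
    exact abs_le.1 this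
  set φ : EuclideanSpace ℝ (Fin (n + 1)) → ℝ := fun v => g' ⟪z, fold n a v⟫ * ⟪b, v⟫ with hφ
  have hφm : Measurable φ := by
    have h1 : Measurable fun v => ⟪z, fold n a v⟫ := by
      have : Measurable fun u : EuclideanSpace ℝ (Fin (n + 1)) => ⟪z, u⟫ :=
        Continuous.measurable (by fun_prop)
      exact this.comp (fold_meas n a)
    exact (hg'c.measurable.comp h1).mul (Continuous.measurable (by fun_prop))
  have hcongr : ∫ v in gball n p r, g ⟪z, fold n a v⟫ * ⟪b, v⟫ ∂μH[(n:ℝ)]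
      = ∫ v in gball n p r, φ v ∂μH[(n:ℝ)] := by
    refine setIntegral_congr_fun hB fun v hv => ?_
    simp only [hφ]
    rw [hg'eq _ (hin v hv.1).1 (hin v hv.1).2]
  rw [hcongr, ← integral_indicator hB]
  have hint : Integrable ((gball n p r).indicator φ) μH[(n:ℝ)] := by
    rw [integrable_indicator_iff hB]
    refine Measure.integrableOn_of_bounded (M := C) ?_ hφm.aestronglyMeasurable ?_
    · exact ((measure_mono fun v hv => hv.1).trans_lt (aux_fin n)).ne
    · refine (ae_restrict_iff' hB).2 (Filter.Eventually.of_forall fun v hv => ?_)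
      have hv1 : ‖v‖ = 1 := by simpa [sph] using hv.1
      have h1 := abs_real_inner_le_norm b v
      rw [hb1, hv1, mul_one] at h1
      simp only [hφ, norm_mul]
      have h2 := hg'C ⟪z, fold n a v⟫
      calc _ ≤ C * 1 := mul_le_mul h2 h1 (abs_nonneg _) ((norm_nonneg _).trans h2)
        _ = C := mul_one C
  obtain ⟨e, he⟩ := exists_refl n b hb
  have hbe : ∀ v, ⟪b, e v⟫ = -⟪b, v⟫ := by
    intro v; rw [he]; simp [inner_sub_right, inner_smul_right, hb1]; ring
  have hpe : ∀ v, ⟪p, e v⟫ = ⟪p, v⟫ - 2 * ⟪b, v⟫ * ⟪b, p⟫ := by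
    intro v; rw [he]; simp [inner_sub_right, inner_smul_right, real_inner_comm]
  have hse : ∀ v, e v ∈ sph n ↔ v ∈ sph n := by
    intro v; simp [sph]
  have hφe : ∀ v, φ (e v) = - φ v := by
    intro v
    have : ⟪z, fold n a (e v)⟫ = ⟪z, fold n a v⟫ := by
      have h1 : ⟪e v, a⟫ = ⟪v, a⟫ := by
        rw [he]; simp [inner_sub_left, inner_smul_left, hba]
      have h2 : ⟪z, e v⟫ = ⟪z, v⟫ := by
        rw [real_inner_comm] at hbz
        rw [he]; simp [inner_sub_right, inner_smul_right, hbz]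
      unfold fold sphRefl
      rw [h1]
      split_ifs <;> simp [inner_sub_right, h2]
    simp only [hφ]
    rw [this, hbe]; ring
  have hmp : MeasurePreserving (fun v => e v) (μH[(n:ℝ)]) (μH[(n:ℝ)]) :=
    e.toIsometryEquiv.measurePreserving_hausdorffMeasure (n : ℝ)
  have hme : MeasurableEmbedding (fun v => e v) :=
    e.toHomeomorph.measurableEmbedding
  generalize hH : (gball n p r).indicator φ = H at *
  have hJ' := hmp.integral_comp hme H
  have hJi : Integrable (fun v => H (e v)) μH[(n:ℝ)] :=
    (hmp.integrable_comp_emb hme (g := H)).2 hint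
  have hsum := integral_add hint hJi
  rw [hJ'] at hsum
  subst hH
  suffices hmain : 0 < ∫ v, ((gball n p r).indicator φ v + (gball n p r).indicator φ (e v))
      ∂μH[(n:ℝ)] by
    linarith
  have hiff := fun v => gball_iff n p v hp r hr0 hrpi
  have hadd : Integrable (fun v => (gball n p r).indicator φ v + (gball n p r).indicator φ (e v))
      μH[(n:ℝ)] := hint.add hJi
  rw [integral_pos_iff_support_of_nonneg _ hadd]
  · obtain ⟨v0, hv0s, hv0a, hv0b⟩ := exists_pt n hn r hr0 hr1 b p hp hbp
    have hO1 : IsOpen {v : EuclideanSpace ℝ (Fin (n + 1)) | Real.cos r < ⟪p, v⟫} :=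
      isOpen_lt continuous_const (by fun_prop)
    have hO2 : IsOpen {v : EuclideanSpace ℝ (Fin (n + 1)) |
        ⟪p, v⟫ - 2 * ⟪b, v⟫ * ⟪b, p⟫ < Real.cos r} :=
      isOpen_lt (by fun_prop) continuous_const
    have hP := aux_pos n _ (hO1.inter hO2) v0 hv0s ⟨hv0a, hv0b⟩
    apply hP.trans_le
    apply measure_mono
    rintro v ⟨⟨h1, h2⟩, hvs⟩
    simp only [Set.mem_ofPred_eq] at h1 h2
    have hvB : v ∈ gball n p r := (hiff v).2 ⟨hvs, h1⟩
    have hevB : e v ∉ gball n p r := by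
      intro h
      have := ((hiff _).1 h).2
      rw [hpe] at this
      linarith
    rw [Function.mem_support, Set.indicator_of_mem hvB, Set.indicator_of_notMem hevB, add_zero]
    have hbv : 0 < ⟪b, v⟫ := by
      by_contra hcon
      push Not at hcon
      nlinarith
    have hv1 : ‖v‖ = 1 := by simpa [sph] using hvs
    have hF1 : ‖fold n a v‖ = 1 := by rw [norm_fold n a v ha, hv1]
    have hbF := inner_fold n a b v hba
    have hlt : ⟪z, fold n a v⟫ < 1 := by
      rw [inner_lt_one_iff_real_of_norm_eq_one hz1 hF1]
      intro h
      rw [← h, hbz] at hbF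
      linarith
    have hgt : -1 < ⟪z, fold n a v⟫ := by
      have : ⟪-z, fold n a v⟫ < 1 := by
        rw [inner_lt_one_iff_real_of_norm_eq_one (by simpa using hz1) hF1]
        intro h
        rw [← h, inner_neg_right, hbz] at hbF
        linarith
      rw [inner_neg_left] at this
      linarith
    simp only [hφ]
    rw [hg'eq _ hgt.le hlt.le]
    exact (mul_pos (hg_pos _ ⟨hgt, hlt⟩) hbv).ne'
  · intro v
    simp only [Pi.zero_apply]
    by_cases h1 : v ∈ gball n p r <;> by_cases h2 : e v ∈ gball n p r
    · rw [Set.indicator_of_mem h1, Set.indicator_of_mem h2, hφe]; simp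
    · rw [Set.indicator_of_mem h1, Set.indicator_of_notMem h2, add_zero]
      change 0 ≤ g' ⟪z, fold n a v⟫ * ⟪b, v⟫
      refine mul_nonneg (hg'0 _) ?_
      by_contra hcon
      push Not at hcon
      refine h2 ((hiff _).2 ⟨(hse v).2 h1.1, ?_⟩)
      have := ((hiff _).1 h1).2
      rw [hpe]; nlinarith
    · rw [Set.indicator_of_notMem h1, Set.indicator_of_mem h2, zero_add, hφe]
      have : 0 ≤ g' ⟪z, fold n a v⟫ * (-⟪b, v⟫) := by
        refine mul_nonneg (hg'0 _) ?_
        by_contra hcon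
        push Not at hcon
        refine h1 ((hiff _).2 ⟨(hse v).1 h2.1, ?_⟩)
        have := ((hiff _).1 h2).2
        rw [hpe] at this; nlinarith
      simp only [hφ]; linarith
    · rw [Set.indicator_of_notMem h1, Set.indicator_of_notMem h2, add_zero]
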